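/- arXiv:2409.04024 — 5 statements merged into one kernel-verified Lean document; each statement's English description precedes it below -/
import Mathlib

section
/- Let −1 < a1 < 0, δ > 0 and a2 > a1/3. Then any two nonconstant periodic solutions of system (III) whose first components satisfy |(γ t).1| < √(−a1) for all t ∈ ℝ have the same image (range) in ℝ × ℝ. (System (III) has at most one small limit cycle surrounding the origin when a2 > a1/3.) -/
/-- A solution of system (III): x' = y − δ(a2 x + x³/3), y' = −x(a1 + x²)(x² − 1). -/
def IsSolIII (a1 a2 δ : ℝ) (γ : ℝ → ℝ × ℝ) : Prop :=
  ∀ t : ℝ, HasDerivAt γ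
    ((γ t).2 - δ * (a2 * (γ t).1 + (γ t).1 ^ 3 / 3),
      -((γ t).1 * (a1 + (γ t).1 ^ 2) * ((γ t).1 ^ 2 - 1))) t

/-- A nonconstant periodic solution of system (III). -/
def IsNonconstPeriodicSolIII (a1 a2 δ : ℝ) (γ : ℝ → ℝ × ℝ) : Prop :=
  IsSolIII a1 a2 δ γ ∧ (∃ T : ℝ, 0 < T ∧ ∀ t : ℝ, γ (t + T) = γ t) ∧
    ¬ (∀ t s : ℝ, γ t = γ s)

open Set Filter Topology

/-- The data of a Liénard equation `x'' + f x x' + g x = 0` on the strip `|x| < s`, where `k` is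
a primitive of `2 g` having the same sign as `f`. -/
structure LienardData (f g k : ℝ → ℝ) (s : ℝ) : Prop where
  deriv_k : ∀ x, HasDerivAt k (2 * g x) x
  f_even : ∀ x, f (-x) = f x
  g_odd : ∀ x, g (-x) = -g x
  k_even : ∀ x, k (-x) = k x
  g_pos : ∀ x, 0 < x → x < s → 0 < g x
  f_pos : ∀ x, |x| < s → 0 < k x → 0 < f x
  f_neg : ∀ x, |x| < s → k x < 0 → f x < 0

/-- An orbit arc in the upper half of the phase plane, written as the graph of `w` over `[a, b]`,
with both end points on the axis `w = 0`. -/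
structure UpperArc (f g k : ℝ → ℝ) (s a b : ℝ) (w : ℝ → ℝ) : Prop where
  left_neg : a < 0
  right_pos : 0 < b
  left_gt : -s < a
  right_lt : b < s
  cont : ContinuousOn w (Icc a b)
  left : w a = 0
  right : w b = 0
  pos : ∀ x ∈ Ioo a b, 0 < w x
  deriv : ∀ x ∈ Ioo a b, HasDerivAt w (-(g x + f x * w x) / w x) x
  energy : ∀ x ∈ Icc a b, 0 < w x ^ 2 + k x

namespace LienardData

variable {f g k : ℝ → ℝ} {s : ℝ}

lemma k_strictMonoOn (h : LienardData f g k s) : StrictMonoOn k (Ico 0 s) := by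
  apply strictMonoOn_of_deriv_pos (convex_Ico 0 s)
  · exact fun x _ => (h.deriv_k x).continuousAt.continuousWithinAt
  · intro x hx
    rw [interior_Ico] at hx
    rw [(h.deriv_k x).deriv]
    linarith [h.g_pos x hx.1 hx.2]

lemma k_abs (h : LienardData f g k s) (x : ℝ) : k |x| = k x := by
  rcases abs_choice x with hx | hx <;> simp [hx, h.k_even]

lemma k_lt_of_abs_lt (h : LienardData f g k s) {x y : ℝ} (hxy : |x| < |y|) (hy : |y| < s) :
    k x < k y := by
  rw [← h.k_abs x, ← h.k_abs y]
  exact h.k_strictMonoOn ⟨abs_nonneg x, hxy.trans hy⟩ ⟨abs_nonneg y, hy⟩ hxy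

lemma k_le_of_abs_le (h : LienardData f g k s) {x y : ℝ} (hxy : |x| ≤ |y|) (hy : |y| < s) :
    k x ≤ k y := by
  rw [← h.k_abs x, ← h.k_abs y]
  exact h.k_strictMonoOn.monotoneOn ⟨abs_nonneg x, hxy.trans_lt hy⟩ ⟨abs_nonneg y, hy⟩ hxy

end LienardData

namespace UpperArc

variable {f g k : ℝ → ℝ} {s a b : ℝ} {w : ℝ → ℝ}

lemma abs_lt (ha : UpperArc f g k s a b w) {x : ℝ} (hx : x ∈ Icc a b) : |x| < s :=
  _root_.abs_lt.2 ⟨ha.left_gt.trans_le hx.1, hx.2.trans_lt ha.right_lt⟩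

lemma k_left_pos (ha : UpperArc f g k s a b w) : 0 < k a := by
  have := ha.energy a ⟨le_rfl, (ha.left_neg.trans ha.right_pos).le⟩
  simpa [ha.left] using this

lemma k_right_pos (ha : UpperArc f g k s a b w) : 0 < k b := by
  have := ha.energy b ⟨(ha.left_neg.trans ha.right_pos).le, le_rfl⟩
  simpa [ha.right] using this

lemma continuousOn_sqrt (h : LienardData f g k s) (ha : UpperArc f g k s a b w) :
    ContinuousOn (fun x => √(w x ^ 2 + k x)) (Icc a b) := by
  have hk : Continuous k := continuous_iff_continuousAt.2 fun x => (h.deriv_k x).continuousAt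
  exact ((ha.cont.pow 2).add hk.continuousOn).sqrt

lemma hasDerivAt_sqrt (h : LienardData f g k s) (ha : UpperArc f g k s a b w) {x : ℝ}
    (hx : x ∈ Ioo a b) :
    HasDerivAt (fun x => √(w x ^ 2 + k x)) (-(f x * (w x / √(w x ^ 2 + k x)))) x := by
  have he := ha.energy x (Ioo_subset_Icc_self hx)
  have hw := ha.pos x hx
  have hd : HasDerivAt (fun x => w x ^ 2 + k x) (-(2 * (f x * w x))) x := by
    refine (((ha.deriv x hx).pow 2).add (h.deriv_k x)).congr_deriv ?_
    have := mul_div_cancel₀ (-(g x + f x * w x)) hw.ne'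
    push_cast
    linear_combination 2 * this
  convert hd.sqrt he.ne' using 1
  have := Real.sqrt_pos.2 he
  field_simp

lemma sqrt_le_of_f_nonneg (h : LienardData f g k s) (ha : UpperArc f g k s a b w) {p q : ℝ}
    (hp : a ≤ p) (hpq : p ≤ q) (hq : q ≤ b) (hf : ∀ x ∈ Icc p q, 0 ≤ f x) :
    √(w q ^ 2 + k q) ≤ √(w p ^ 2 + k p) := by
  have hsub : Ioo p q ⊆ Ioo a b := Ioo_subset_Ioo hp hq
  refine antitoneOn_of_deriv_nonpos (convex_Icc p q)
    ((ha.continuousOn_sqrt h).mono (Icc_subset_Icc hp hq)) ?_ ?_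
    ⟨le_rfl, hpq⟩ ⟨hpq, le_rfl⟩ hpq
  · rw [interior_Icc]
    exact fun x hx => (ha.hasDerivAt_sqrt h (hsub hx)).differentiableAt.differentiableWithinAt
  · rw [interior_Icc]
    intro x hx
    rw [(ha.hasDerivAt_sqrt h (hsub hx)).deriv, neg_nonpos]
    have := ha.pos x (hsub hx)
    have := hf x (Ioo_subset_Icc_self hx)
    positivity

lemma sqrt_le_sqrt_sq_add (k w : ℝ → ℝ) (x : ℝ) : √(k x) ≤ √(w x ^ 2 + k x) :=
  Real.sqrt_le_sqrt (by nlinarith [sq_nonneg (w x)])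

variable {a₁ b₁ a₂ b₂ : ℝ} {w₁ w₂ : ℝ → ℝ}

lemma abs_right_le (h : LienardData f g k s) (h₁ : UpperArc f g k s a₁ b₁ w₁)
    (h₂ : UpperArc f g k s a₂ b₂ w₂) (hb : b₁ ≤ b₂) :
    |√(k b₂) - √(k b₁)| ≤ |√(w₂ b₁ ^ 2 + k b₁) - √(w₁ b₁ ^ 2 + k b₁)| := by
  have hle : √(k b₁) ≤ √(k b₂) := Real.sqrt_le_sqrt <| h.k_le_of_abs_le
    (by rwa [abs_of_pos h₁.right_pos, abs_of_pos h₂.right_pos])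
    (h₂.abs_lt ⟨(h₂.left_neg.trans h₂.right_pos).le, le_rfl⟩)
  have hmono := h₂.sqrt_le_of_f_nonneg h (h₂.left_neg.trans h₁.right_pos).le hb le_rfl
    fun x hx => (h.f_pos x (h₂.abs_lt ⟨by linarith [hx.1, h₂.left_neg, h₁.right_pos], hx.2⟩)
      (h₁.k_right_pos.trans_le (h.k_le_of_abs_le
        (by rw [abs_of_pos h₁.right_pos]; exact hx.1.trans (le_abs_self x))
        (h₂.abs_lt ⟨by linarith [hx.1, h₂.left_neg, h₁.right_pos], hx.2⟩)))).le
  simp only [h₁.right, h₂.right, ne_eq, OfNat.ofNat_ne_zero, not_false_eq_true, zero_pow,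
    zero_add] at hmono ⊢
  rw [abs_of_nonneg (by linarith), abs_of_nonneg (by linarith)]
  linarith

lemma abs_left_le (h : LienardData f g k s) (h₁ : UpperArc f g k s a₁ b₁ w₁)
    (h₂ : UpperArc f g k s a₂ b₂ w₂) (hab : a₂ ≤ a₁) :
    |√(w₂ a₁ ^ 2 + k a₁) - √(w₁ a₁ ^ 2 + k a₁)| ≤ |√(k a₂) - √(k a₁)| := by
  have hle := sqrt_le_sqrt_sq_add k w₂ a₁
  have hmono := h₂.sqrt_le_of_f_nonneg h le_rfl hab (h₁.left_neg.trans h₂.right_pos).le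
    fun x hx => (h.f_pos x (h₂.abs_lt ⟨hx.1, by linarith [hx.2, h₁.left_neg, h₂.right_pos]⟩)
      (h₁.k_left_pos.trans_le (h.k_le_of_abs_le
        (by rw [abs_of_neg h₁.left_neg]; exact (neg_le_neg hx.2).trans (neg_le_abs x))
        (h₂.abs_lt ⟨hx.1, by linarith [hx.2, h₁.left_neg, h₂.right_pos]⟩)))).le
  simp only [h₁.left, h₂.left, ne_eq, OfNat.ofNat_ne_zero, not_false_eq_true, zero_pow,
    zero_add] at hmono ⊢
  rw [abs_of_nonneg (by linarith), abs_of_nonneg (by linarith)]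
  linarith

lemma mul_sub_div_eq {u₁ u₂ v₁ v₂ κ : ℝ} (hu₁ : 0 < u₁) (hu₂ : 0 < u₂) (hv₁ : 0 < v₁)
    (hv₂ : 0 < v₂) (e₁ : u₁ ^ 2 = v₁ ^ 2 + κ) (e₂ : u₂ ^ 2 = v₂ ^ 2 + κ) :
    (u₂ - u₁) * (v₂ / u₂ - v₁ / u₁) =
      κ * ((u₂ - u₁) ^ 2 * ((u₂ + u₁) / ((v₂ * u₁ + v₁ * u₂) * (u₁ * u₂)))) := by
  have : 0 < v₂ * u₁ + v₁ * u₂ := by positivity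
  field_simp
  have e : κ * (u₂ ^ 2 - u₁ ^ 2) = v₂ ^ 2 * u₁ ^ 2 - v₁ ^ 2 * u₂ ^ 2 := by
    rw [e₁, e₂]; ring
  linear_combination (-(u₂ - u₁)) * e

/-- The squared distance of two arcs decreases, strictly unless they coincide. -/
lemma abs_sub_le (h : LienardData f g k s) (h₁ : UpperArc f g k s a₁ b₁ w₁)
    (h₂ : UpperArc f g k s a₂ b₂ w₂) {A B : ℝ} (hA₁ : a₁ ≤ A) (hA₂ : a₂ ≤ A) (hA : A < 0)
    (hB₁ : B ≤ b₁) (hB₂ : B ≤ b₂) (hB : 0 < B) :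
    |√(w₂ B ^ 2 + k B) - √(w₁ B ^ 2 + k B)| < |√(w₂ A ^ 2 + k A) - √(w₁ A ^ 2 + k A)| ∨
      √(w₂ B ^ 2 + k B) - √(w₁ B ^ 2 + k B) = 0 ∧
      √(w₂ A ^ 2 + k A) - √(w₁ A ^ 2 + k A) = 0 := by
  set D : ℝ → ℝ := fun x => √(w₂ x ^ 2 + k x) - √(w₁ x ^ 2 + k x) with hD
  have hsub₁ : Ioo A B ⊆ Ioo a₁ b₁ := Ioo_subset_Ioo hA₁ hB₁
  have hsub₂ : Ioo A B ⊆ Ioo a₂ b₂ := Ioo_subset_Ioo hA₂ hB₂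
  have key : ∀ x ∈ Ioo A B, ∃ c > 0, HasDerivAt (fun x => D x ^ 2)
      (-(2 * (f x * k x) * (c * D x ^ 2))) x := by
    intro x hx
    have he₁ := h₁.energy x (Ioo_subset_Icc_self (hsub₁ hx))
    have he₂ := h₂.energy x (Ioo_subset_Icc_self (hsub₂ hx))
    have hp₁ := h₁.pos x (hsub₁ hx)
    have hp₂ := h₂.pos x (hsub₂ hx)
    have hu₁ := Real.sqrt_pos.2 he₁
    have hu₂ := Real.sqrt_pos.2 he₂
    set u₁ := √(w₁ x ^ 2 + k x) with hu₁_def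
    set u₂ := √(w₂ x ^ 2 + k x) with hu₂_def
    refine ⟨(u₂ + u₁) / ((w₂ x * u₁ + w₁ x * u₂) * (u₁ * u₂)), by positivity, ?_⟩
    · refine (((h₂.hasDerivAt_sqrt h (hsub₂ hx)).sub
        (h₁.hasDerivAt_sqrt h (hsub₁ hx))).pow 2).congr_deriv ?_
      have := mul_sub_div_eq hu₁ hu₂ hp₁ hp₂ (Real.sq_sqrt he₁.le) (Real.sq_sqrt he₂.le)
      simp only [Pi.sub_apply, hD, ← hu₁_def, ← hu₂_def]
      push_cast
      linear_combination (-2 * f x) * this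
  have hfk : ∀ x ∈ Ioo A B, 0 ≤ f x * k x := by
    intro x hx
    have hs := h₁.abs_lt (Ioo_subset_Icc_self (hsub₁ hx))
    rcases lt_trichotomy (k x) 0 with hk | hk | hk
    · exact (mul_pos_of_neg_of_neg (h.f_neg x hs hk) hk).le
    · simp [hk]
    · exact (mul_pos (h.f_pos x hs hk) hk).le
  have hAB : A < B := hA.trans hB
  have hanti : AntitoneOn (fun x => D x ^ 2) (Icc A B) := by
    apply antitoneOn_of_deriv_nonpos (convex_Icc A B)
    · exact (((h₂.continuousOn_sqrt h).mono (Icc_subset_Icc hA₂ hB₂)).sub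
        ((h₁.continuousOn_sqrt h).mono (Icc_subset_Icc hA₁ hB₁))).pow 2
    · rw [interior_Icc]
      intro x hx
      obtain ⟨c, -, hc⟩ := key x hx
      exact hc.differentiableAt.differentiableWithinAt
    · rw [interior_Icc]
      intro x hx
      obtain ⟨c, hc0, hc⟩ := key x hx
      rw [hc.deriv, neg_nonpos]
      have := hfk x hx
      positivity
  have hAm : A ∈ Icc A B := ⟨le_rfl, hAB.le⟩
  have hBm : B ∈ Icc A B := ⟨hAB.le, le_rfl⟩
  change |D B| < |D A| ∨ D B = 0 ∧ D A = 0
  rcases (hanti hAm hBm hAB.le).lt_or_eq with hlt | heq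
  · exact Or.inl (sq_lt_sq.1 hlt)
  right
  obtain ⟨x, hx, hkx⟩ : ∃ x ∈ Ioo A B, k x ≠ 0 := by
    by_contra! hall
    have h2 := hall (B / 2) ⟨by linarith, by linarith⟩
    have h3 := hall (B / 3) ⟨by linarith, by linarith⟩
    have := h.k_strictMonoOn (a := B / 3) (b := B / 2)
      ⟨by positivity, by linarith [h₁.right_lt]⟩ ⟨by positivity, by linarith [h₁.right_lt]⟩
      (by linarith)
    linarith
  have hs := h₁.abs_lt (Ioo_subset_Icc_self (hsub₁ hx))
  have hfx : f x ≠ 0 := by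
    rcases hkx.lt_or_gt with hk | hk
    · exact (h.f_neg x hs hk).ne
    · exact (h.f_pos x hs hk).ne'
  have hconst : ∀ y ∈ Ioo A B, D y ^ 2 = D A ^ 2 := fun y hy =>
    le_antisymm (hanti hAm (Ioo_subset_Icc_self hy) hy.1.le)
      (heq.symm.le.trans (hanti (Ioo_subset_Icc_self hy) hBm hy.2.le))
  obtain ⟨c, hc0, hc⟩ := key x hx
  have hloc : (fun y => D y ^ 2) =ᶠ[𝓝 x] fun _ => D A ^ 2 :=
    eventually_of_mem (Ioo_mem_nhds hx.1 hx.2) hconst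
  have h0 := hc.unique ((hasDerivAt_const x (D A ^ 2)).congr_of_eventuallyEq hloc)
  have hDx : D x ^ 2 = 0 := by
    simpa [hfx, hkx, hc0.ne'] using h0
  rw [hconst x hx] at hDx
  have hDA : D A = 0 := by simpa using hDx
  refine ⟨?_, hDA⟩
  simpa [hDA] using heq

/-- The transition map from the left to the right end point is a strict contraction. -/
lemma contraction (h : LienardData f g k s) (h₁ : UpperArc f g k s a₁ b₁ w₁)
    (h₂ : UpperArc f g k s a₂ b₂ w₂) :
    |√(k b₂) - √(k b₁)| < |√(k a₂) - √(k a₁)| ∨ √(k b₂) - √(k b₁) = 0 := by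
  wlog hb : b₁ ≤ b₂ generalizing a₁ b₁ w₁ a₂ b₂ w₂
  · rw [abs_sub_comm, abs_sub_comm (√(k a₂)), sub_eq_zero, eq_comm, ← sub_eq_zero]
    exact this h₂ h₁ (le_of_not_ge hb)
  have hr := abs_right_le h h₁ h₂ hb
  rcases le_total a₂ a₁ with ha | ha
  · have hl := abs_left_le h h₁ h₂ ha
    rcases abs_sub_le h h₁ h₂ le_rfl ha h₁.left_neg le_rfl hb h₁.right_pos with hm | ⟨hm, -⟩
    · exact Or.inl (hr.trans_lt (hm.trans_le hl))
    · rw [hm, abs_zero] at hr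
      exact Or.inr (abs_nonpos_iff.1 hr)
  · have hl := abs_left_le h h₂ h₁ ha
    rw [abs_sub_comm, abs_sub_comm (√(k a₁))] at hl
    rcases abs_sub_le h h₁ h₂ ha le_rfl h₂.left_neg le_rfl hb h₁.right_pos with hm | ⟨hm, -⟩
    · exact Or.inl (hr.trans_lt (hm.trans_le hl))
    · rw [hm, abs_zero] at hr
      exact Or.inr (abs_nonpos_iff.1 hr)

end UpperArc

/-- A strictly increasing continuous function on a compact interval has a continuous inverse. -/
lemma exists_continuous_leftInvOn {x : ℝ → ℝ} {p q : ℝ} (hpq : p ≤ q)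
    (hc : ContinuousOn x (Icc p q)) (hm : StrictMonoOn x (Icc p q)) :
    ∃ τ : ℝ → ℝ, Continuous τ ∧ ∀ t ∈ Icc p q, τ (x t) = t := by
  set P : ℝ → ℝ := fun t => projIcc p q hpq t with hP
  have hPm : ∀ t, P t ∈ Icc p q := fun t => (projIcc p q hpq t).2
  have hPc : Continuous P := continuous_subtype_val.comp continuous_projIcc
  have hPeq : ∀ t ∈ Icc p q, P t = t := fun t ht => by simp [hP, projIcc_of_mem hpq ht]
  have hXc : Continuous fun t => x (P t) + (t - P t) :=
    (hc.comp_continuous hPc hPm).add (continuous_id.sub hPc)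
  have hPval : ∀ t, P t = max p (min q t) := fun t => coe_projIcc p q hpq t
  have hXm : StrictMono fun t => x (P t) + (t - P t) := by
    intro t₁ t₂ ht
    have h1 : P t₁ ≤ P t₂ := monotone_projIcc hpq ht.le
    have h2 : t₁ - P t₁ ≤ t₂ - P t₂ := by
      rw [hPval, hPval]; grind
    rcases h1.lt_or_eq with hlt | heq
    · have := hm (hPm t₁) (hPm t₂) hlt
      dsimp only
      linarith
    · dsimp only
      rw [heq]
      linarith
  have hb : ∀ t, x p - q ≤ x (P t) - P t ∧ x (P t) - P t ≤ x q - p := fun t => by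
    have h1 := hm.monotoneOn ⟨le_rfl, hpq⟩ (hPm t) (hPm t).1
    have h2 := hm.monotoneOn (hPm t) ⟨hpq, le_rfl⟩ (hPm t).2
    constructor <;> linarith [(hPm t).1, (hPm t).2]
  have hXs : Function.Surjective fun t => x (P t) + (t - P t) := by
    apply hXc.surjective
    · exact tendsto_atTop_mono (fun t => by rw [id_eq]; linarith [(hb t).1])
        (tendsto_atTop_add_const_right atTop (x p - q) tendsto_id)
    · exact tendsto_atBot_mono (fun t => by rw [id_eq]; linarith [(hb t).2])
        (tendsto_atBot_add_const_right atBot (x q - p) tendsto_id)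
  let e := hXm.orderIsoOfSurjective _ hXs
  refine ⟨e.symm, e.symm.continuous, fun t ht => ?_⟩
  rw [OrderIso.symm_apply_eq]
  simp [e, hPeq t ht]

/-- A function with negative derivative at a zero is positive just before it. -/
lemma exists_pos_left_of_deriv_neg {z : ℝ → ℝ} {t m : ℝ} (hz : HasDerivAt z m t) (hm : m < 0)
    (h0 : z t = 0) : ∃ r < t, ∀ τ ∈ Ioo r t, 0 < z τ := by
  have h := eventually_nhdsWithin_sign_eq_of_deriv_neg (by rwa [hz.deriv]) h0
  obtain ⟨r, hr, hsub⟩ := mem_nhdsLE_iff_exists_Ioc_subset.1 (nhdsWithin_le_nhds (s := Iic t) h)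
  refine ⟨r, hr, fun τ hτ => ?_⟩
  have hs : SignType.sign (z τ) = SignType.sign (t - τ) := hsub ⟨hτ.1, hτ.2.le⟩
  rwa [sign_pos (sub_pos.2 hτ.2), sign_eq_one_iff] at hs

/-- A periodic orbit of `x'' + f x x' + g x = 0` in the strip `|x| < s` avoiding the origin. -/
structure PeriodicOrbit (f g : ℝ → ℝ) (s : ℝ) (x z : ℝ → ℝ) : Prop where
  deriv_x : ∀ t, HasDerivAt x (z t) t
  deriv_z : ∀ t, HasDerivAt z (-(g (x t) + f (x t) * z t)) t
  periodic_x : ∃ T > 0, Function.Periodic x T ∧ Function.Periodic z T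
  strip : ∀ t, |x t| < s
  ne_zero : ∀ t, z t = 0 → x t ≠ 0

namespace PeriodicOrbit

variable {f g k x z : ℝ → ℝ} {s : ℝ}

lemma neg (h : LienardData f g k s) (ho : PeriodicOrbit f g s x z) :
    PeriodicOrbit f g s (-x) (-z) where
  deriv_x t := (ho.deriv_x t).neg
  deriv_z t := by
    refine (ho.deriv_z t).neg.congr_deriv ?_
    simp only [Pi.neg_apply, h.f_even, h.g_odd]
    ring
  periodic_x := by
    obtain ⟨T, hT, h1, h2⟩ := ho.periodic_x
    exact ⟨T, hT, fun t => by simp [h1 t], fun t => by simp [h2 t]⟩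
  strip t := by simpa using ho.strip t
  ne_zero t ht := by simpa using ho.ne_zero t (by simpa using ht)

lemma continuous_x (ho : PeriodicOrbit f g s x z) : Continuous x :=
  continuous_iff_continuousAt.2 fun t => (ho.deriv_x t).continuousAt

lemma continuous_z (ho : PeriodicOrbit f g s x z) : Continuous z :=
  continuous_iff_continuousAt.2 fun t => (ho.deriv_z t).continuousAt

lemma hasDerivAt_energy (h : LienardData f g k s) (ho : PeriodicOrbit f g s x z) (t : ℝ) :
    HasDerivAt (fun t => z t ^ 2 + k (x t)) (-(2 * (f (x t) * z t ^ 2))) t := by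
  refine (((ho.deriv_z t).pow 2).add ((h.deriv_k (x t)).comp t (ho.deriv_x t))).congr_deriv ?_
  push_cast
  ring

/-- An orbit cannot reach the minimum of a nonpositive energy at a point with `x > 0`, `z = 0`. -/
lemma energy_min_pos (h : LienardData f g k s) (ho : PeriodicOrbit f g s x z) {t : ℝ}
    (hmin : ∀ τ, z t ^ 2 + k (x t) ≤ z τ ^ 2 + k (x τ)) (hz : z t = 0) (hx : 0 < x t) :
    0 < z t ^ 2 + k (x t) := by
  by_contra! hle
  simp only [hz, ne_eq, OfNat.ofNat_ne_zero, not_false_eq_true, zero_pow, zero_add] at hle hmin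
  have hg := h.g_pos _ hx ((le_abs_self _).trans_lt (ho.strip t))
  obtain ⟨r, hr, hpos⟩ := exists_pos_left_of_deriv_neg (ho.deriv_z t) (by simp [hz, hg]) hz
  obtain ⟨r', hr', hpos'⟩ : ∃ r' < t, ∀ τ ∈ Ioc r' t, 0 < x τ :=
    mem_nhdsLE_iff_exists_Ioc_subset.1
      (nhdsWithin_le_nhds (s := Iic t) (ho.continuous_x.continuousAt.eventually_const_lt hx))
  have hR : max r r' < t := max_lt hr hr'
  have hxm : StrictMonoOn x (Icc (max r r') t) := by
    apply strictMonoOn_of_deriv_pos (convex_Icc _ _) ho.continuous_x.continuousOn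
    rw [interior_Icc]
    intro τ hτ
    rw [(ho.deriv_x τ).deriv]
    exact hpos τ ⟨(le_max_left _ _).trans_lt hτ.1, hτ.2⟩
  have hem : StrictMonoOn (fun t => z t ^ 2 + k (x t)) (Icc (max r r') t) := by
    apply strictMonoOn_of_deriv_pos (convex_Icc _ _)
    · exact fun τ _ => (ho.hasDerivAt_energy h τ).continuousAt.continuousWithinAt
    rw [interior_Icc]
    intro τ hτ
    rw [(ho.hasDerivAt_energy h τ).deriv]
    have hzτ := hpos τ ⟨(le_max_left _ _).trans_lt hτ.1, hτ.2⟩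
    have hxτ := hpos' τ ⟨(le_max_right _ _).trans_lt hτ.1, hτ.2.le⟩
    have hlt := hxm (Ioo_subset_Icc_self hτ) ⟨hR.le, le_rfl⟩ hτ.2
    have hk := h.k_lt_of_abs_lt (by rwa [abs_of_pos hxτ, abs_of_pos hx]) (ho.strip t)
    have hf := h.f_neg _ (ho.strip τ) (hk.trans_le hle)
    nlinarith [mul_pos_of_neg_of_neg hf (neg_lt_zero.2 (pow_pos hzτ 2))]
  have := hem ⟨le_rfl, hR.le⟩ ⟨hR.le, le_rfl⟩ hR
  simp only [hz, ne_eq, OfNat.ofNat_ne_zero, not_false_eq_true, zero_pow, zero_add] at this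
  exact absurd (hmin _) (not_le.2 this)

lemma energy_pos (h : LienardData f g k s) (ho : PeriodicOrbit f g s x z) (t : ℝ) :
    0 < z t ^ 2 + k (x t) := by
  obtain ⟨T, hT, hxT, hzT⟩ := ho.periodic_x
  have hper : Function.Periodic (fun t => z t ^ 2 + k (x t)) T := fun t => by simp [hxT t, hzT t]
  have hcont : Continuous fun t => z t ^ 2 + k (x t) :=
    continuous_iff_continuousAt.2 fun t => (ho.hasDerivAt_energy h t).continuousAt
  obtain ⟨t₀, -, ht₀⟩ := isCompact_Icc.exists_isMinOn (nonempty_Icc.2 hT.le) hcont.continuousOn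
  have hmin : ∀ τ, z t₀ ^ 2 + k (x t₀) ≤ z τ ^ 2 + k (x τ) := fun τ => by
    obtain ⟨σ, hσ, hστ⟩ := hper.exists_mem_Ico₀ hT τ
    exact (ht₀ (Ico_subset_Icc_self hσ)).trans_eq hστ.symm
  refine lt_of_lt_of_le ?_ (hmin t)
  have hcrit := IsLocalMin.hasDerivAt_eq_zero (Eventually.of_forall hmin)
    (ho.hasDerivAt_energy h t₀)
  by_cases hz : z t₀ = 0
  · rcases (ho.ne_zero t₀ hz).lt_or_gt with hx | hx
    · have := (ho.neg h).energy_min_pos h (t := t₀) (by simpa [h.k_even] using hmin)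
        (by simpa using hz) (by simpa using hx)
      simpa [h.k_even] using this
    · exact ho.energy_min_pos h hmin hz hx
  · have hf : f (x t₀) = 0 := by simpa [hz] using hcrit
    have hk : k (x t₀) = 0 := by
      by_contra hk
      rcases Ne.lt_or_gt hk with hk | hk
      · exact (h.f_neg _ (ho.strip t₀) hk).ne hf
      · exact (h.f_pos _ (ho.strip t₀) hk).ne' hf
    rw [hk, add_zero]
    positivity

/-- Following an orbit backwards from a crossing of the positive `x`-axis gives an upper arc. -/
lemma exists_upperArc (h : LienardData f g k s) (ho : PeriodicOrbit f g s x z) {t : ℝ}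
    (hz : z t = 0) (hx : 0 < x t) :
    ∃ t₀ w, z t₀ = 0 ∧ UpperArc f g k s (x t₀) (x t) w := by
  have hg := h.g_pos _ hx ((le_abs_self _).trans_lt (ho.strip t))
  obtain ⟨r, hr, hpos⟩ := exists_pos_left_of_deriv_neg (ho.deriv_z t) (by simp [hz, hg]) hz
  set S : Set ℝ := {τ | z τ ≤ 0} ∩ Iic r with hS
  have hne : S.Nonempty := by
    by_contra hemp
    have hall : ∀ τ < t, 0 < z τ := fun τ hτ => by
      rcases le_or_gt τ r with hτr | hτr
      · by_contra! hle
        exact hemp ⟨τ, hle, hτr⟩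
      · exact hpos τ ⟨hτr, hτ⟩
    obtain ⟨T, hT, hxT, -⟩ := ho.periodic_x
    have hm : StrictMonoOn x (Iic t) := by
      apply strictMonoOn_of_deriv_pos (convex_Iic _) ho.continuous_x.continuousOn
      rw [interior_Iic]
      intro τ hτ
      rw [(ho.deriv_x τ).deriv]
      exact hall τ hτ
    have := hm (a := t - T) (b := t) (by simp [hT.le]) self_mem_Iic (by linarith)
    rw [hxT.sub_eq] at this
    exact this.false
  have hbdd : BddAbove S := ⟨r, fun τ hτ => hτ.2⟩
  have hcl : IsClosed S := (isClosed_le ho.continuous_z continuous_const).inter isClosed_Iic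
  obtain ⟨t₀, hmem, hmax⟩ : ∃ t₀ ∈ S, ∀ τ ∈ S, τ ≤ t₀ :=
    ⟨sSup S, hcl.csSup_mem hne hbdd, fun τ hτ => le_csSup hbdd hτ⟩
  have hlt : t₀ < t := lt_of_le_of_lt hmem.2 hr
  have hzpos : ∀ τ ∈ Ioo t₀ t, 0 < z τ := fun τ hτ => by
    rcases le_or_gt τ r with hτr | hτr
    · by_contra! hle
      exact absurd (hmax τ ⟨hle, hτr⟩) (not_le.2 hτ.1)
    · exact hpos τ ⟨hτr, hτ.2⟩
  have hz₀ : z t₀ = 0 := by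
    refine le_antisymm hmem.1 ?_
    have hcl' : IsClosed {τ | 0 ≤ z τ} := isClosed_le continuous_const ho.continuous_z
    have hsub : Icc t₀ t ⊆ {τ | 0 ≤ z τ} := by
      rw [← closure_Ioo hlt.ne]
      exact closure_minimal (fun τ hτ => (hzpos τ hτ).le) hcl'
    exact hsub ⟨le_rfl, hlt.le⟩
  have hx₀ : x t₀ < 0 := by
    refine lt_of_le_of_ne ?_ (ho.ne_zero t₀ hz₀)
    by_contra! hx₀
    have hg₀ := h.g_pos _ hx₀ ((le_abs_self _).trans_lt (ho.strip t₀))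
    have hs := eventually_nhdsWithin_sign_eq_of_deriv_neg
      (by rw [(ho.deriv_z t₀).deriv]; simp [hz₀, hg₀]) hz₀
    obtain ⟨τ, hτ, hτs⟩ := (((eventually_mem_set.2 (Ioo_mem_nhdsGT hlt))).and
      (eventually_nhdsWithin_of_eventually_nhds hs)).exists
    rw [sign_pos (hzpos τ hτ), sign_neg (sub_neg.2 hτ.1)] at hτs
    exact absurd hτs (by decide)
  have hm : StrictMonoOn x (Icc t₀ t) := by
    apply strictMonoOn_of_deriv_pos (convex_Icc _ _) ho.continuous_x.continuousOn
    rw [interior_Icc]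
    intro τ hτ
    rw [(ho.deriv_x τ).deriv]
    exact hzpos τ hτ
  obtain ⟨θ, hθc, hθ⟩ := exists_continuous_leftInvOn hlt.le ho.continuous_x.continuousOn hm
  have himg : Icc (x t₀) (x t) ⊆ x '' Icc t₀ t :=
    intermediate_value_Icc hlt.le ho.continuous_x.continuousOn
  have himg' : Ioo (x t₀) (x t) ⊆ x '' Ioo t₀ t :=
    intermediate_value_Ioo hlt.le ho.continuous_x.continuousOn
  refine ⟨t₀, z ∘ θ, hz₀, ?_⟩
  constructor
  · exact hx₀
  · exact hx
  · exact (abs_lt.1 (ho.strip t₀)).1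
  · exact (abs_lt.1 (ho.strip t)).2
  · exact (ho.continuous_z.comp hθc).continuousOn
  · simp [hθ t₀ ⟨le_rfl, hlt.le⟩, hz₀]
  · simp [hθ t ⟨hlt.le, le_rfl⟩, hz]
  · intro y hy
    obtain ⟨τ, hτ, rfl⟩ := himg' hy
    simpa [hθ τ (Ioo_subset_Icc_self hτ)] using hzpos τ hτ
  · intro y hy
    have hloc : ∀ᶠ p in 𝓝 y, x (θ p) = p := by
      filter_upwards [Ioo_mem_nhds hy.1 hy.2] with p hp
      obtain ⟨τ, hτ, rfl⟩ := himg' hp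
      rw [hθ τ (Ioo_subset_Icc_self hτ)]
    obtain ⟨τ, hτ, rfl⟩ := himg' hy
    have hθτ := hθ τ (Ioo_subset_Icc_self hτ)
    have hzτ := hzpos τ hτ
    have hd := HasDerivAt.of_local_left_inverse hθc.continuousAt (ho.deriv_x (θ (x τ)))
      (by rw [hθτ]; exact hzτ.ne') hloc
    have hd' := (ho.deriv_z (θ (x τ))).comp (x τ) hd
    simpa only [Function.comp_apply, hθτ, div_eq_mul_inv] using hd'
  · intro y hy
    obtain ⟨τ, hτ, rfl⟩ := himg hy
    simpa [hθ τ hτ] using ho.energy_pos h τ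

/-- Every periodic orbit crosses the `x`-axis. -/
lemma exists_z_eq_zero (ho : PeriodicOrbit f g s x z) : ∃ t, z t = 0 := by
  obtain ⟨T, hT, hxT, -⟩ := ho.periodic_x
  obtain ⟨c, -, hc⟩ := exists_hasDerivAt_eq_zero hT ho.continuous_x.continuousOn
    (by simpa using (hxT 0).symm) fun t _ => ho.deriv_x t
  exact ⟨c, hc⟩

/-- Every distance at which an orbit crosses the `x`-axis is the right end of an upper arc. -/
lemma exists_upperArc_abs (h : LienardData f g k s) (ho : PeriodicOrbit f g s x z) {t : ℝ}
    (hz : z t = 0) :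
    ∃ t₀ a w, z t₀ = 0 ∧ |x t₀| = |a| ∧ x t₀ * x t < 0 ∧ UpperArc f g k s a |x t| w := by
  rcases (ho.ne_zero t hz).lt_or_gt with hx | hx
  · obtain ⟨t₀, w, hz₀, ha⟩ := (ho.neg h).exists_upperArc h (t := t) (by simpa using hz)
      (by simpa using hx)
    refine ⟨t₀, -x t₀, w, by simpa using hz₀, (abs_neg _).symm, ?_, by rwa [abs_of_neg hx]⟩
    have := ha.left_neg
    simp only [Pi.neg_apply] at this
    nlinarith
  · obtain ⟨t₀, w, hz₀, ha⟩ := ho.exists_upperArc h hz hx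
    exact ⟨t₀, x t₀, w, hz₀, rfl, mul_neg_of_neg_of_pos ha.left_neg hx, by rwa [abs_of_pos hx]⟩

/-- The distances from the origin at which an orbit crosses the `x`-axis form a compact set. -/
lemma isCompact_crossings (ho : PeriodicOrbit f g s x z) :
    IsCompact ((fun t => |x t|) '' {t | z t = 0}) := by
  obtain ⟨T, hT, hxT, hzT⟩ := ho.periodic_x
  have heq : (fun t => |x t|) '' {t | z t = 0} =
      (fun t => |x t|) '' (Icc 0 T ∩ {t | z t = 0}) := by
    refine Subset.antisymm ?_ (image_mono inter_subset_right)
    rintro _ ⟨t, ht, rfl⟩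
    have hp : Function.Periodic (fun t => (x t, z t)) T := fun t => by simp [hxT t, hzT t]
    obtain ⟨σ, hσ, hσt⟩ := hp.exists_mem_Ico₀ hT t
    obtain ⟨e1, e2⟩ := Prod.mk.inj hσt
    exact ⟨σ, ⟨Ico_subset_Icc_self hσ, e2.symm.trans ht⟩, by simp [e1]⟩
  rw [heq]
  exact (isCompact_Icc.inter_right (isClosed_eq ho.continuous_z continuous_const)).image
    ho.continuous_x.abs

/-- Two periodic orbits cross the positive `x`-axis at a common point. -/
lemma exists_common_point (h : LienardData f g k s) {x₁ z₁ x₂ z₂ : ℝ → ℝ}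
    (h₁ : PeriodicOrbit f g s x₁ z₁) (h₂ : PeriodicOrbit f g s x₂ z₂) :
    ∃ t₁ t₂, x₁ t₁ = x₂ t₂ ∧ z₁ t₁ = z₂ t₂ := by
  set S : Set ℝ := (fun t => |x₁ t|) '' {t | z₁ t = 0} ∪ (fun t => |x₂ t|) '' {t | z₂ t = 0}
    with hS
  have hcomp : IsCompact S := h₁.isCompact_crossings.union h₂.isCompact_crossings
  obtain ⟨τ₁, hτ₁⟩ := h₁.exists_z_eq_zero
  obtain ⟨τ₂, hτ₂⟩ := h₂.exists_z_eq_zero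
  have hm₁ : ∀ t, z₁ t = 0 → |x₁ t| ∈ S := fun t ht => Or.inl ⟨t, ht, rfl⟩
  have hm₂ : ∀ t, z₂ t = 0 → |x₂ t| ∈ S := fun t ht => Or.inr ⟨t, ht, rfl⟩
  have hne : S.Nonempty := ⟨_, hm₁ _ hτ₁⟩
  have harc : ∀ b ∈ S, ∃ a w, |a| ∈ S ∧ UpperArc f g k s a b w := by
    rintro _ (⟨t, ht, rfl⟩ | ⟨t, ht, rfl⟩)
    · obtain ⟨t₀, a, w, hz₀, hax, -, ha⟩ := h₁.exists_upperArc_abs h ht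
      exact ⟨a, w, hax ▸ hm₁ t₀ hz₀, ha⟩
    · obtain ⟨t₀, a, w, hz₀, hax, -, ha⟩ := h₂.exists_upperArc_abs h ht
      exact ⟨a, w, hax ▸ hm₂ t₀ hz₀, ha⟩
  obtain ⟨M, hM, hMmax⟩ := hcomp.exists_isGreatest hne
  obtain ⟨m, hm, hmmin⟩ := hcomp.exists_isLeast hne
  obtain ⟨aM, wM, haM, hM'⟩ := harc M hM
  obtain ⟨am, wm, ham, hm'⟩ := harc m hm
  have hMs : |M| < s := by rw [abs_of_pos hM'.right_pos]; exact hM'.right_lt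
  have hbound : ∀ a, |a| ∈ S → √(k m) ≤ √(k a) ∧ √(k a) ≤ √(k M) := fun a ha => by
    have h1 : |m| ≤ |a| := by rw [abs_of_pos hm'.right_pos]; exact hmmin ha
    have h2 : |a| ≤ |M| := by rw [abs_of_pos hM'.right_pos]; exact hMmax ha
    exact ⟨Real.sqrt_le_sqrt (h.k_le_of_abs_le h1 (h2.trans_lt hMs)),
      Real.sqrt_le_sqrt (h.k_le_of_abs_le h2 hMs)⟩
  have hkeq : √(k M) - √(k m) = 0 := by
    rcases UpperArc.contraction h hm' hM' with hlt | heq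
    · exfalso
      have := le_abs_self (√(k M) - √(k m))
      rcases abs_cases (√(k aM) - √(k am)) with hc | hc <;>
        linarith [(hbound aM haM).1, (hbound aM haM).2, (hbound am ham).1, (hbound am ham).2]
    · exact heq
  have hmM : m = M := by
    refine (hMmax hm).eq_of_not_lt fun hlt => ?_
    have := h.k_lt_of_abs_lt (x := m) (y := M)
      (by rwa [abs_of_pos hm'.right_pos, abs_of_pos hM'.right_pos]) hMs
    have := Real.sqrt_lt_sqrt hm'.k_right_pos.le this
    linarith
  have hall : ∀ b ∈ S, b = M := fun b hb => le_antisymm (hMmax hb) (hmM ▸ hmmin hb)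
  have hcross : ∀ {x z : ℝ → ℝ}, PeriodicOrbit f g s x z → (∀ t, z t = 0 → |x t| = M) →
      ∃ t, x t = M ∧ z t = 0 := by
    intro x z ho habs
    obtain ⟨t, ht⟩ := ho.exists_z_eq_zero
    obtain ⟨t₀, -, -, hz₀, -, hneg, -⟩ := ho.exists_upperArc_abs h ht
    have e := habs t ht
    have e₀ := habs t₀ hz₀
    rcases (ho.ne_zero t ht).lt_or_gt with hx | hx
    · exact ⟨t₀, by rwa [abs_of_pos (by nlinarith)] at e₀, hz₀⟩
    · exact ⟨t, by rwa [abs_of_pos hx] at e, ht⟩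
  obtain ⟨t₁, e₁, e₁'⟩ := hcross h₁ fun t ht => hall _ (hm₁ t ht)
  obtain ⟨t₂, e₂, e₂'⟩ := hcross h₂ fun t ht => hall _ (hm₂ t ht)
  exact ⟨t₁, t₂, e₁.trans e₂.symm, e₁'.trans e₂'.symm⟩

end PeriodicOrbit

/-- Bounded solutions of system (III) that agree at one time are equal. -/
lemma IsSolIII.eq_of_eq {a1 a2 δ : ℝ} {γ₁ γ₂ : ℝ → ℝ × ℝ} (h₁ : IsSolIII a1 a2 δ γ₁)
    (h₂ : IsSolIII a1 a2 δ γ₂) (hb₁ : Bornology.IsBounded (range γ₁))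
    (hb₂ : Bornology.IsBounded (range γ₂)) {t : ℝ} (ht : γ₁ t = γ₂ t) : γ₁ = γ₂ := by
  set v : ℝ × ℝ → ℝ × ℝ := fun p =>
    (p.2 - δ * (a2 * p.1 + p.1 ^ 3 / 3), -(p.1 * (a1 + p.1 ^ 2) * (p.1 ^ 2 - 1))) with hv
  have hvc : ContDiff ℝ 1 v := by fun_prop
  have hK : IsCompact (closure (range γ₁ ∪ range γ₂)) := (hb₁.union hb₂).isCompact_closure
  obtain ⟨K, hLip⟩ :=
    hvc.locallyLipschitz.locallyLipschitzOn.exists_lipschitzOnWith_of_compact hK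
  exact ODE_solution_unique_univ (v := fun _ => v)
    (s := fun _ => closure (range γ₁ ∪ range γ₂)) (fun _ => hLip)
    (fun τ => ⟨h₁ τ, subset_closure (Or.inl ⟨τ, rfl⟩)⟩)
    (fun τ => ⟨h₂ τ, subset_closure (Or.inr ⟨τ, rfl⟩)⟩) ht

lemma IsSolIII.comp_add_const {a1 a2 δ : ℝ} {γ : ℝ → ℝ × ℝ} (h : IsSolIII a1 a2 δ γ) (c : ℝ) :
    IsSolIII a1 a2 δ fun t => γ (t + c) :=
  fun t => (h (t + c)).comp_add_const t c

lemma IsNonconstPeriodicSolIII.isBounded_range {a1 a2 δ : ℝ} {γ : ℝ → ℝ × ℝ}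
    (h : IsNonconstPeriodicSolIII a1 a2 δ γ) : Bornology.IsBounded (range γ) := by
  obtain ⟨hs, ⟨T, hT, hper⟩, -⟩ := h
  have hc : Continuous γ := continuous_iff_continuousAt.2 fun t => (hs t).continuousAt
  exact (Function.Periodic.compact_of_continuous hper hT.ne' hc).isBounded

/-- Twice the potential energy `∫ g` of system (III), as a function of `X = x²`. -/
noncomputable def potentialIII (a1 X : ℝ) : ℝ := X ^ 3 / 3 + (a1 - 1) * X ^ 2 / 2 - a1 * X

lemma potentialIII_lt {a1 X Y : ℝ} (ha1 : -1 < a1) (hXY : X < Y) (hY : Y ≤ -a1) :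
    potentialIII a1 X < potentialIII a1 Y := by
  obtain ⟨α, rfl⟩ : ∃ α, X = -a1 - α := ⟨-a1 - X, by ring⟩
  obtain ⟨β, rfl⟩ : ∃ β, Y = -a1 - β := ⟨-a1 - Y, by ring⟩
  have hβ : 0 ≤ β := by linarith
  have hα : β < α := by linarith
  have : 0 < (α - β) * ((α ^ 2 + α * β + β ^ 2) / 3 + (1 + a1) * (α + β) / 2) := by
    have : 0 < 1 + a1 := by linarith
    have : 0 < α := by linarith
    have : 0 < α - β := by linarith
    positivity
  unfold potentialIII
  linear_combination this

lemma lienardData_III {a1 a2 δ : ℝ} (ha1l : -1 < a1) (ha1r : a1 < 0) (hδ : 0 < δ)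
    (ha2 : a1 / 3 < a2) :
    LienardData (fun x => δ * (a2 + x ^ 2)) (fun x => x * (a1 + x ^ 2) * (x ^ 2 - 1))
      (fun x => potentialIII a1 (x ^ 2) - potentialIII a1 (max (-a2) 0)) √(-a1) where
  deriv_k x := by
    unfold potentialIII
    have h2 : HasDerivAt (fun x : ℝ => x ^ 2) (2 * x) x := by simpa using hasDerivAt_pow 2 x
    refine (((((h2.pow 3).div_const 3).add (((h2.pow 2).const_mul (a1 - 1)).div_const 2)).sub
      (h2.const_mul a1)).sub_const _).congr_deriv ?_
    push_cast
    ring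
  f_even x := by ring
  g_odd x := by ring
  k_even x := by simp
  g_pos x hx hxs := by
    have hsq : x ^ 2 < -a1 := (Real.lt_sqrt hx.le).1 hxs
    have := mul_pos_of_neg_of_neg (show a1 + x ^ 2 < 0 by linarith)
      (show x ^ 2 - 1 < 0 by linarith)
    rw [mul_assoc]
    positivity
  f_pos x hxs hk := by
    have hmax : max (-a2) 0 ≤ -a1 := max_le (by linarith) (by linarith)
    have hlt : max (-a2) 0 < x ^ 2 := by
      by_contra! hle
      rcases hle.lt_or_eq with h | h
      · linarith [potentialIII_lt ha1l h hmax]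
      · simp [h] at hk
    have := (le_max_left (-a2) 0).trans_lt hlt
    exact mul_pos hδ (by linarith)
  f_neg x hxs hk := by
    have hsq : x ^ 2 < -a1 := by
      rw [← sq_abs]
      exact (Real.lt_sqrt (abs_nonneg x)).1 hxs
    have hlt : x ^ 2 < max (-a2) 0 := by
      by_contra! hle
      rcases hle.lt_or_eq with h | h
      · linarith [potentialIII_lt ha1l h hsq.le]
      · simp [h] at hk
    have := (lt_max_iff.1 hlt).resolve_right (sq_nonneg x).not_gt
    exact mul_neg_of_pos_of_neg hδ (by linarith)

lemma IsNonconstPeriodicSolIII.periodicOrbit {a1 a2 δ : ℝ} {γ : ℝ → ℝ × ℝ}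
    (h : IsNonconstPeriodicSolIII a1 a2 δ γ) (hs : ∀ t, |(γ t).1| < √(-a1)) :
    PeriodicOrbit (fun x => δ * (a2 + x ^ 2)) (fun x => x * (a1 + x ^ 2) * (x ^ 2 - 1)) √(-a1)
      (fun t => (γ t).1) (fun t => (γ t).2 - δ * (a2 * (γ t).1 + (γ t).1 ^ 3 / 3)) where
  deriv_x t := (hasFDerivAt_fst (𝕜 := ℝ) (E := ℝ) (F := ℝ)).comp_hasDerivAt t (h.1 t)
  deriv_z t := by
    have hx : HasDerivAt (fun t => (γ t).1) _ t := hasFDerivAt_fst.comp_hasDerivAt t (h.1 t)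
    have hy : HasDerivAt (fun t => (γ t).2) _ t := hasFDerivAt_snd.comp_hasDerivAt t (h.1 t)
    refine (hy.sub (((hx.const_mul a2).add ((hx.pow 3).div_const 3)).const_mul δ)).congr_deriv ?_
    simp only [ContinuousLinearMap.coe_fst', ContinuousLinearMap.coe_snd']
    push_cast
    ring
  periodic_x := by
    obtain ⟨T, hT, hper⟩ := h.2.1
    exact ⟨T, hT, fun t => by simp [hper t], fun t => by simp [hper t]⟩
  strip := hs
  ne_zero t hz hx := by
    have hy : (γ t).2 = 0 := by simpa [hx] using hz
    have h0 : IsSolIII a1 a2 δ fun _ => 0 := fun τ => by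
      refine (hasDerivAt_const τ (0 : ℝ × ℝ)).congr_deriv ?_
      simp [Prod.zero_eq_mk]
    have hb0 : Bornology.IsBounded (range fun _ : ℝ => (0 : ℝ × ℝ)) := by simp
    have heq := h.1.eq_of_eq h0 h.isBounded_range hb0 (t := t) (Prod.ext hx hy)
    exact h.2.2 fun τ σ => by rw [heq]

/-- for −1 < a1 < 0, δ > 0, a2 > a1/3, any two nonconstant periodic
solutions of system (III) lying in the strip |x| < √(−a1) have the same image
(at most one small limit cycle surrounding the origin). -/
theorem stmt12 (a1 a2 δ : ℝ) (ha1l : -1 < a1) (ha1r : a1 < 0) (hδ : 0 < δ)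
    (ha2 : a1 / 3 < a2) :
    ∀ γ1 γ2 : ℝ → ℝ × ℝ,
      IsNonconstPeriodicSolIII a1 a2 δ γ1 →
      (∀ t : ℝ, |(γ1 t).1| < Real.sqrt (-a1)) →
      IsNonconstPeriodicSolIII a1 a2 δ γ2 →
      (∀ t : ℝ, |(γ2 t).1| < Real.sqrt (-a1)) →
      Set.range γ1 = Set.range γ2 := by
  intro γ1 γ2 h1 hs1 h2 hs2
  obtain ⟨t₁, t₂, hx, hz⟩ := PeriodicOrbit.exists_common_point
    (lienardData_III ha1l ha1r hδ ha2) (h1.periodicOrbit hs1) (h2.periodicOrbit hs2)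
  have hpt : γ1 t₁ = γ2 t₂ := by
    refine Prod.ext hx ?_
    rw [hx] at hz
    linarith
  have hrange : range (fun t => γ2 (t + (t₂ - t₁))) = range γ2 :=
    (Equiv.addRight (t₂ - t₁)).surjective.range_comp γ2
  have heq := h1.1.eq_of_eq (h2.1.comp_add_const (t₂ - t₁)) h1.isBounded_range
    (by rw [hrange]; exact h2.isBounded_range) (t := t₁) (by simpa using hpt)
  rw [heq, hrange]
end

section
/- Let a1 ≥ 0. Then there do not exist real numbers x1, x2 with 0 < x1 < 1 < x2 such that x1³/3 − x1 = x2³/3 − x2 and x1·(a1 + x1²) = x2·(a1 + x2²). (Both equations together force a1 = −3, which is impossible for a1 ≥ 0.) -/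
/-- for a1 ≥ 0, there are no 0 < x1 < 1 < x2 with
x1³/3 − x1 = x2³/3 − x2 and x1(a1 + x1²) = x2(a1 + x2²). -/
theorem stmt13 (a1 : ℝ) (ha1 : 0 ≤ a1) :
    ¬ ∃ x1 x2 : ℝ, 0 < x1 ∧ x1 < 1 ∧ 1 < x2 ∧
      x1 ^ 3 / 3 - x1 = x2 ^ 3 / 3 - x2 ∧
      x1 * (a1 + x1 ^ 2) = x2 * (a1 + x2 ^ 2) := by
  rintro ⟨x1, x2, -, h1, h2, hF, hg⟩
  have hlt : x1 < x2 := h1.trans h2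
  have hprod : (a1 + 3) * (x2 - x1) = 0 := by linear_combination 3 * hF - hg
  have hpos : 0 < (a1 + 3) * (x2 - x1) := mul_pos (by linarith) (sub_pos.mpr hlt)
  exact hpos.ne' hprod
end

section
/- Let −1/3 < a1 < 0. Then there do not exist real numbers x1, x2 with 0 < x1 < √3/3 < x2 < 1 such that x1³ − x1 = x2³ − x2 and (x1² − 1/3)·x2·(a1 + x2²)·(x2² − 1) = (x2² − 1/3)·x1·(a1 + x1²)·(x1² − 1). -/
/-- for −1/3 < a1 < 0, there are no 0 < x1 < √3/3 < x2 < 1 with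
x1³ − x1 = x2³ − x2 and
(x1² − 1/3)·x2(a1 + x2²)(x2² − 1) = (x2² − 1/3)·x1(a1 + x1²)(x1² − 1). -/
theorem stmt14 (a1 : ℝ) (ha1l : -1/3 < a1) (ha1r : a1 < 0) :
    ¬ ∃ x1 x2 : ℝ, 0 < x1 ∧ x1 < Real.sqrt 3 / 3 ∧ Real.sqrt 3 / 3 < x2 ∧ x2 < 1 ∧
      x1 ^ 3 - x1 = x2 ^ 3 - x2 ∧
      (x1 ^ 2 - 1/3) * (x2 * (a1 + x2 ^ 2) * (x2 ^ 2 - 1))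
        = (x2 ^ 2 - 1/3) * (x1 * (a1 + x1 ^ 2) * (x1 ^ 2 - 1)) := by
  rintro ⟨x1, x2, h0, h1, h2, h3, hF, hfg⟩
  have hlt : x1 < x2 := h1.trans h2
  have hne : x1 ^ 3 - x1 ≠ 0 := by
    have hx1 : x1 ^ 2 < 1 := by nlinarith
    nlinarith [mul_pos h0 (sub_pos.2 hx1)]
  have hprod : (x1 ^ 3 - x1) * ((a1 + 1 / 3) * ((x2 - x1) * (x2 + x1))) = 0 := by
    linear_combination -hfg - (x1 ^ 2 - 1 / 3) * (a1 + x2 ^ 2) * hF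
  have hpos : 0 < (a1 + 1 / 3) * ((x2 - x1) * (x2 + x1)) :=
    mul_pos (by linarith) (mul_pos (by linarith) (by linarith))
  exact mul_ne_zero hne hpos.ne' hprod
end

section
/- Let a1 ≥ 0. The function x ↦ (x³/3 − x + 2/3)/(x·(x² + a1)) is strictly monotonically increasing on the open interval (1, ∞). -/
/-- for a1 ≥ 0, the function x ↦ (x³/3 − x + 2/3)/(x(x² + a1)) is
strictly increasing on (1, ∞). -/
theorem stmt15 (a1 : ℝ) (ha1 : 0 ≤ a1) :
    StrictMonoOn (fun x : ℝ => (x ^ 3 / 3 - x + 2/3) / (x * (x ^ 2 + a1)))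
      (Set.Ioi (1 : ℝ)) := by
  intro x hx y hy hxy
  rw [Set.mem_Ioi] at hx hy
  have hx0 : 0 < x := by linarith
  have hy0 : 0 < y := by linarith
  have hxy1 : 1 < x * y := by nlinarith
  have h_lin : 0 ≤ x * y * (x + y) - 2 := by nlinarith
  have h_const : 0 < 3 * (x * y) * (x + y) - 2 * (x ^ 2 + x * y + y ^ 2) := by
    have h₁ : 0 < x ^ 2 * (y - 1) := mul_pos (by positivity) (by linarith)
    have h₂ : 0 < y ^ 2 * (x - 1) := mul_pos (by positivity) (by linarith)
    linarith [sq_nonneg (x - y)]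
  have h_diff : 0 < (y - x) * (a1 * (x * y * (x + y) - 2) +
      (3 * (x * y) * (x + y) - 2 * (x ^ 2 + x * y + y ^ 2))) :=
    mul_pos (by linarith) (by linarith [mul_nonneg ha1 h_lin])
  show (x ^ 3 / 3 - x + 2/3) / (x * (x ^ 2 + a1)) < (y ^ 3 / 3 - y + 2/3) / (y * (y ^ 2 + a1))
  rw [div_lt_div_iff₀ (by positivity) (by positivity)]
  linarith
end

section
/- Take a1 = −1/3 and define Q(x, e) = 2e − x²/3 + (2/3)·x⁴ − x⁶/3. Let η : ℝ → ℝ be a function such that for every e > 2/81 one has η(e) > 0, Q(η(e), e) = 0, and Q(x, e) > 0 for all x with |x| < η(e). For i ∈ {0, 2} define I_i(e) = ∫_{−η(e)}^{η(e)} x^i·√(Q(x, e)) dx. Then for every a2 < −1/3, the set {e ∈ ℝ : e > 2/81 and a2·I_0(e) + I_2(e) = 0} has at most two elements. -/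
open intervalIntegral

/-- The quadratic factor in
`U (U - 1)² - U v (U v - 1)² = U (1 - v) · ovalFactor U v`. -/
def ovalFactor (U v : ℝ) : ℝ := U ^ 2 * (1 + v + v ^ 2) - 2 * U * (1 + v) + 1

/-- The integral of `√(U (U - 1)² - (x³ - x)²)` over the oval, after `x = √U sin θ`. -/
noncomputable def ovalIntegral (U : ℝ) : ℝ :=
  ∫ θ in (-(Real.pi / 2))..(Real.pi / 2),
    U * Real.cos θ ^ 2 * √(ovalFactor U (Real.sin θ ^ 2))

/-- The complete elliptic integral of the first kind attached to the oval. -/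
noncomputable def ovalPeriod (U : ℝ) : ℝ :=
  ∫ θ in (-(Real.pi / 2))..(Real.pi / 2), (√(ovalFactor U (Real.sin θ ^ 2)))⁻¹

lemma ovalFactor_pos {U : ℝ} (hU : 4 / 3 < U) (v : ℝ) : 0 < ovalFactor U v := by
  unfold ovalFactor
  nlinarith [sq_nonneg (2 * U * v + U - 2), mul_pos (by linarith : 0 < U)
    (by linarith : 0 < 3 * U - 4)]

lemma ovalFactor_lt {U V v : ℝ} (hU : 4 / 3 < U) (hUV : U < V) (hv : 0 ≤ v) :
    ovalFactor U v < ovalFactor V v := by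
  have hdiff : ovalFactor V v - ovalFactor U v =
      (V - U) * ((U + V) * (1 + v + v ^ 2) - 2 * (1 + v)) := by
    unfold ovalFactor; ring
  have hpos : 0 < (U + V) * (1 + v + v ^ 2) - 2 * (1 + v) := by
    nlinarith [mul_pos (by linarith : 0 < U + V - 2) (by positivity : 0 < 1 + v + v ^ 2),
      sq_nonneg v]
  nlinarith [mul_pos (sub_pos.2 hUV) hpos]

lemma continuous_ovalFactor_sin (U : ℝ) :
    Continuous fun θ : ℝ => ovalFactor U (Real.sin θ ^ 2) := by
  unfold ovalFactor; fun_prop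

lemma continuous_inv_sqrt_ovalFactor {U : ℝ} (hU : 4 / 3 < U) :
    Continuous fun θ : ℝ => (√(ovalFactor U (Real.sin θ ^ 2)))⁻¹ :=
  (continuous_ovalFactor_sin U).sqrt.inv₀ fun _ => (Real.sqrt_pos.2 (ovalFactor_pos hU _)).ne'

lemma ovalPeriod_lt {U V : ℝ} (hU : 4 / 3 < U) (hUV : U < V) : ovalPeriod V < ovalPeriod U := by
  have hlt (θ : ℝ) : (√(ovalFactor V (Real.sin θ ^ 2)))⁻¹ <
      (√(ovalFactor U (Real.sin θ ^ 2)))⁻¹ := by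
    have hpos := ovalFactor_pos hU (Real.sin θ ^ 2)
    exact inv_strictAnti₀ (Real.sqrt_pos.2 hpos)
      (Real.sqrt_lt_sqrt hpos.le (ovalFactor_lt hU hUV (sq_nonneg _)))
  have hpi := Real.pi_pos
  exact integral_lt_integral_of_continuousOn_of_le_of_exists_lt (by linarith)
    (continuous_inv_sqrt_ovalFactor (hU.trans hUV)).continuousOn
    (continuous_inv_sqrt_ovalFactor hU).continuousOn (fun _ _ => (hlt _).le)
    ⟨0, ⟨by linarith, by linarith⟩, hlt 0⟩

/-- Differentiating the integrand of `ovalIntegral` in `U`. -/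
noncomputable def ovalIntegrandDeriv (U θ : ℝ) : ℝ :=
  Real.cos θ ^ 2 * √(ovalFactor U (Real.sin θ ^ 2)) + U * Real.cos θ ^ 2 *
    ((2 * U * (1 + Real.sin θ ^ 2 + (Real.sin θ ^ 2) ^ 2) - 2 * (1 + Real.sin θ ^ 2)) /
      (2 * √(ovalFactor U (Real.sin θ ^ 2))))

lemma hasDerivAt_ovalIntegrand {U : ℝ} (hU : 4 / 3 < U) (θ : ℝ) :
    HasDerivAt (fun U => U * Real.cos θ ^ 2 * √(ovalFactor U (Real.sin θ ^ 2)))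
      (ovalIntegrandDeriv U θ) U := by
  have hq : HasDerivAt (fun U => ovalFactor U (Real.sin θ ^ 2))
      (2 * U * (1 + Real.sin θ ^ 2 + (Real.sin θ ^ 2) ^ 2) - 2 * (1 + Real.sin θ ^ 2)) U := by
    unfold ovalFactor
    refine ((((hasDerivAt_pow 2 U).mul_const _).sub
      (((hasDerivAt_id U).const_mul 2).mul_const _)).add_const 1).congr_deriv ?_
    push_cast; ring
  refine (((hasDerivAt_id U).mul_const _).mul (hq.sqrt (ovalFactor_pos hU _).ne')).congr_deriv ?_
  simp [ovalIntegrandDeriv]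

lemma continuousOn_ovalIntegrandDeriv :
    ContinuousOn (fun p : ℝ × ℝ => ovalIntegrandDeriv p.1 p.2) (Set.Ioi (4 / 3) ×ˢ Set.univ) := by
  have hq : Continuous fun p : ℝ × ℝ => √(ovalFactor p.1 (Real.sin p.2 ^ 2)) := by
    unfold ovalFactor; fun_prop
  unfold ovalIntegrandDeriv
  refine ContinuousOn.add (by fun_prop) (ContinuousOn.mul (by fun_prop) (ContinuousOn.div
    (by fun_prop) (hq.const_mul 2).continuousOn fun p hp => ?_))
  exact (mul_pos two_pos (Real.sqrt_pos.2 (ovalFactor_pos hp.1 _))).ne'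

lemma continuous_ovalIntegrandDeriv {U : ℝ} (hU : 4 / 3 < U) :
    Continuous (ovalIntegrandDeriv U) :=
  continuousOn_ovalIntegrandDeriv.comp_continuous (f := fun θ : ℝ => (U, θ)) (by fun_prop)
    fun _ => ⟨hU, trivial⟩

lemma integral_ovalIntegrandDeriv {U : ℝ} (hU : 4 / 3 < U) :
    ∫ θ in (-(Real.pi / 2))..(Real.pi / 2), ovalIntegrandDeriv U θ =
      (U - 1) * (3 * U - 1) / 2 * ovalPeriod U := by
  have hderiv (θ : ℝ) : HasDerivAt
      (fun θ => Real.sin θ * Real.cos θ * √(ovalFactor U (Real.sin θ ^ 2)) / 2)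
      (ovalIntegrandDeriv U θ -
        (U - 1) * (3 * U - 1) / 2 * (√(ovalFactor U (Real.sin θ ^ 2)))⁻¹) θ := by
    have hpos := ovalFactor_pos hU (Real.sin θ ^ 2)
    have hv : HasDerivAt (fun θ => Real.sin θ ^ 2) (2 * Real.sin θ * Real.cos θ) θ := by
      simpa using! (Real.hasDerivAt_sin θ).pow 2
    have hq : HasDerivAt (fun θ => ovalFactor U (Real.sin θ ^ 2))
        ((U ^ 2 * (1 + 2 * Real.sin θ ^ 2) - 2 * U) * (2 * Real.sin θ * Real.cos θ)) θ := by
      unfold ovalFactor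
      refine (((((hv.const_add 1).add (hv.pow 2)).const_mul (U ^ 2)).sub
        ((hv.const_add 1).const_mul (2 * U))).add_const 1).congr_deriv ?_
      push_cast; ring
    refine ((((Real.hasDerivAt_sin θ).mul (Real.hasDerivAt_cos θ)).mul
      (hq.sqrt hpos.ne')).div_const 2).congr_deriv ?_
    have hs := Real.sqrt_pos.2 hpos
    have hss := Real.sq_sqrt hpos.le
    have hc := Real.cos_sq' θ
    unfold ovalIntegrandDeriv
    simp only [Pi.mul_apply]
    set r := √(ovalFactor U (Real.sin θ ^ 2))
    field_simp
    rw [hss]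
    unfold ovalFactor
    set c := Real.cos θ
    set s := Real.sin θ
    linear_combination
      (-1 + 2 * s ^ 2 * U - 2 * s ^ 2 * U ^ 2 - s ^ 4 * U ^ 2 + 4 * U - 3 * U ^ 2) * hc
  have hint1 := (continuous_ovalIntegrandDeriv hU).intervalIntegrable (μ := MeasureTheory.volume)
    (-(Real.pi / 2)) (Real.pi / 2)
  have hint2 := ((continuous_inv_sqrt_ovalFactor hU).const_mul
    ((U - 1) * (3 * U - 1) / 2)).intervalIntegrable (μ := MeasureTheory.volume)
    (-(Real.pi / 2)) (Real.pi / 2)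
  have h := integral_eq_sub_of_hasDerivAt (fun θ _ => hderiv θ) (hint1.sub hint2)
  rw [integral_sub hint1 hint2, integral_const_mul] at h
  simp only [Real.cos_neg, Real.cos_pi_div_two, mul_zero, zero_mul, zero_div, sub_zero] at h
  exact sub_eq_zero.1 h

lemma hasDerivAt_ovalIntegral {U : ℝ} (hU : 4 / 3 < U) :
    HasDerivAt ovalIntegral ((U - 1) * (3 * U - 1) / 2 * ovalPeriod U) U := by
  obtain ⟨a, ha, haU⟩ := exists_between hU
  have hK : IsCompact (Set.Icc a (U + 1) ×ˢ Set.Icc (-(Real.pi / 2)) (Real.pi / 2)) :=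
    isCompact_Icc.prod isCompact_Icc
  obtain ⟨C, hC⟩ := hK.exists_bound_of_continuousOn (continuousOn_ovalIntegrandDeriv.mono
    (Set.prod_mono (fun x hx => ha.trans_le hx.1) (Set.subset_univ _)))
  have hpi := Real.pi_pos
  have hcont (V : ℝ) : Continuous fun θ : ℝ =>
      V * Real.cos θ ^ 2 * √(ovalFactor V (Real.sin θ ^ 2)) :=
    (by fun_prop : Continuous fun θ : ℝ => V * Real.cos θ ^ 2).mul
      (continuous_ovalFactor_sin V).sqrt
  rw [← integral_ovalIntegrandDeriv hU]
  refine (hasDerivAt_integral_of_dominated_loc_of_deriv_le (bound := fun _ => C)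
    (Icc_mem_nhds haU (lt_add_one U)) (Filter.Eventually.of_forall fun V =>
      (hcont V).aestronglyMeasurable) ((hcont U).intervalIntegrable _ _)
    (continuous_ovalIntegrandDeriv hU).aestronglyMeasurable ?_ intervalIntegrable_const ?_).2
  · refine Filter.Eventually.of_forall fun θ hθ V hV => hC (V, θ) ⟨hV, ?_⟩
    rw [Set.uIoc_of_le (by linarith)] at hθ
    exact Set.Ioc_subset_Icc_self hθ
  · exact Filter.Eventually.of_forall fun θ _ V hV =>
      hasDerivAt_ovalIntegrand (ha.trans_le hV.1) θ

lemma hasDerivAt_ovalIntegral_combination (a k : ℝ) {U : ℝ} (hU : 4 / 3 < U) :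
    HasDerivAt (fun U => a * ovalIntegral U + k * (U * (U - 1) ^ 2))
      ((U - 1) * (3 * U - 1) * (a / 2 * ovalPeriod U + k)) U := by
  have hs : HasDerivAt (fun U : ℝ => U * (U - 1) ^ 2) ((U - 1) * (3 * U - 1)) U := by
    refine ((hasDerivAt_id U).mul (((hasDerivAt_id U).sub_const 1).pow 2)).congr_deriv ?_
    simp; ring
  exact (((hasDerivAt_ovalIntegral hU).const_mul a).add (hs.const_mul k)).congr_deriv (by ring)

/-- Rolle's theorem applied twice, using that the period is strictly decreasing. -/
lemma ovalIntegral_combination_not_three_zeros {a k U V W : ℝ} (ha : a ≠ 0) (hU : 4 / 3 < U)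
    (hUV : U < V) (hVW : V < W) (hU0 : a * ovalIntegral U + k * (U * (U - 1) ^ 2) = 0)
    (hV0 : a * ovalIntegral V + k * (V * (V - 1) ^ 2) = 0)
    (hW0 : a * ovalIntegral W + k * (W * (W - 1) ^ 2) = 0) : False := by
  have key {A B : ℝ} (hA : 4 / 3 < A) (hAB : A < B)
      (hA0 : a * ovalIntegral A + k * (A * (A - 1) ^ 2) = 0)
      (hB0 : a * ovalIntegral B + k * (B * (B - 1) ^ 2) = 0) :
      ∃ x ∈ Set.Ioo A B, a / 2 * ovalPeriod x + k = 0 := by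
    obtain ⟨x, hx, hx0⟩ := exists_hasDerivAt_eq_zero hAB
      (fun x hx => (hasDerivAt_ovalIntegral_combination a k
        (hA.trans_le hx.1)).continuousAt.continuousWithinAt) (hA0.trans hB0.symm)
      (fun x hx => hasDerivAt_ovalIntegral_combination a k (hA.trans hx.1))
    have hx43 := hA.trans hx.1
    have hne : (x - 1) * (3 * x - 1) ≠ 0 :=
      (mul_pos (by linarith) (by linarith)).ne'
    exact ⟨x, hx, (mul_eq_zero.1 hx0).resolve_left hne⟩
  obtain ⟨x, hx, hx0⟩ := key hU hUV hU0 hV0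
  obtain ⟨y, hy, hy0⟩ := key (hU.trans hUV) hVW hV0 hW0
  have hlt := ovalPeriod_lt (hU.trans hx.1) (hx.2.trans hy.1)
  have : a / 2 * (ovalPeriod x - ovalPeriod y) = 0 := by linear_combination hx0 - hy0
  rcases mul_eq_zero.1 this with h | h
  · exact ha (by linarith)
  · linarith

lemma integral_sqrt_sub_cubic_sq {h : ℝ} (hh : 0 < h) :
    ∫ x in (-h)..h, √(h ^ 2 * (h ^ 2 - 1) ^ 2 - (x ^ 3 - x) ^ 2) = ovalIntegral (h ^ 2) := by
  have hsub := integral_comp_mul_deriv (a := -(Real.pi / 2)) (b := Real.pi / 2)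
    (f := fun θ => h * Real.sin θ) (f' := fun θ => h * Real.cos θ)
    (g := fun x => √(h ^ 2 * (h ^ 2 - 1) ^ 2 - (x ^ 3 - x) ^ 2))
    (fun θ _ => (Real.hasDerivAt_sin θ).const_mul h) (by fun_prop) (by fun_prop)
  simp only [Real.sin_neg, Real.sin_pi_div_two, mul_neg, mul_one] at hsub
  rw [← hsub]
  refine integral_congr fun θ hθ => ?_
  have hpi := Real.pi_pos
  rw [Set.uIcc_of_le (by linarith)] at hθ
  have hcos := Real.cos_nonneg_of_mem_Icc hθ
  have hfac : h ^ 2 * (h ^ 2 - 1) ^ 2 - ((h * Real.sin θ) ^ 3 - h * Real.sin θ) ^ 2 =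
      (h * Real.cos θ) ^ 2 * ovalFactor (h ^ 2) (Real.sin θ ^ 2) := by
    rw [mul_pow h (Real.cos θ), Real.cos_sq']
    unfold ovalFactor
    ring
  simp only [Function.comp_apply]
  rw [hfac, Real.sqrt_mul (sq_nonneg _), Real.sqrt_sq (by positivity)]
  ring

lemma integral_sqrt_sq_sub_sq (c : ℝ) :
    ∫ w in (-c)..c, √(c ^ 2 - w ^ 2) = |c| * c * (Real.pi / 2) := by
  have h := mul_integral_comp_mul_left (a := -1) (b := 1)
    (f := fun w => √(c ^ 2 - w ^ 2)) c
  simp only [mul_neg, mul_one] at h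
  rw [← h, ← integral_sqrt_one_sub_sq, mul_comm |c| c, mul_assoc,
    ← integral_const_mul |c| fun w : ℝ => √(1 - w ^ 2)]
  congr 1
  refine integral_congr fun w _ => ?_
  rw [show c ^ 2 - (c * w) ^ 2 = c ^ 2 * (1 - w ^ 2) by ring, Real.sqrt_mul (sq_nonneg _),
    Real.sqrt_sq_eq_abs]

lemma integral_deriv_cubic_mul_sqrt {h : ℝ} (hh : 1 ≤ h) :
    ∫ x in (-h)..h, √(h ^ 2 * (h ^ 2 - 1) ^ 2 - (x ^ 3 - x) ^ 2) * (3 * x ^ 2 - 1) =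
      Real.pi / 2 * (h ^ 2 * (h ^ 2 - 1) ^ 2) := by
  have hsub := integral_comp_mul_deriv (a := -h) (b := h)
    (f := fun x => x ^ 3 - x) (f' := fun x => 3 * x ^ 2 - 1)
    (g := fun w => √((h ^ 3 - h) ^ 2 - w ^ 2))
    (fun x _ => by simpa using! (hasDerivAt_pow 3 x).sub (hasDerivAt_id x))
    (by fun_prop) (by fun_prop)
  rw [show (-h) ^ 3 - -h = -(h ^ 3 - h) by ring, integral_sqrt_sq_sub_sq,
    abs_of_nonneg (by nlinarith [mul_nonneg (by linarith : 0 ≤ h) (by nlinarith : 0 ≤ h ^ 2 - 1)])]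
    at hsub
  simp only [Function.comp_def] at hsub
  rw [show h ^ 2 * (h ^ 2 - 1) ^ 2 = (h ^ 3 - h) ^ 2 by ring, hsub]
  ring

lemma ovalIntegral_combination_eq_zero {a h : ℝ} (hh : 1 ≤ h)
    (h0 : a * (∫ x in (-h)..h, √((h ^ 2 * (h ^ 2 - 1) ^ 2 - (x ^ 3 - x) ^ 2) / 3)) +
      ∫ x in (-h)..h, x ^ 2 * √((h ^ 2 * (h ^ 2 - 1) ^ 2 - (x ^ 3 - x) ^ 2) / 3) = 0) :
    (3 * a + 1) * ovalIntegral (h ^ 2) + Real.pi / 2 * (h ^ 2 * (h ^ 2 - 1) ^ 2) = 0 := by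
  have hs3 : 0 < √3 := by positivity
  simp only [Real.sqrt_div' _ (by norm_num : (0 : ℝ) ≤ 3), ← mul_div_assoc, integral_div] at h0
  rw [← integral_deriv_cubic_mul_sqrt hh, ← integral_sqrt_sub_cubic_sq (by linarith)]
  set S := fun x : ℝ => √(h ^ 2 * (h ^ 2 - 1) ^ 2 - (x ^ 3 - x) ^ 2) with hS
  have hcont : Continuous S := by fun_prop
  have hsplit : ∫ x in (-h)..h, S x * (3 * x ^ 2 - 1) =
      3 * (∫ x in (-h)..h, x ^ 2 * S x) - ∫ x in (-h)..h, S x := by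
    rw [← integral_const_mul, ← integral_sub
      ((by fun_prop : Continuous fun x => 3 * (x ^ 2 * S x)).intervalIntegrable _ _)
      (hcont.intervalIntegrable _ _)]
    exact integral_congr fun x _ => by ring
  change (3 * a + 1) * (∫ x in (-h)..h, S x) + ∫ x in (-h)..h, S x * (3 * x ^ 2 - 1) = 0
  change a * (∫ x in (-h)..h, S x) / √3 + (∫ x in (-h)..h, x ^ 2 * S x) / √3 = 0 at h0
  rw [← add_div, div_eq_zero_iff, or_iff_left hs3.ne'] at h0
  rw [hsplit]
  linear_combination 3 * h0


/-- with a1 = −1/3 and Q(x, e) = 2e − x²/3 + (2/3)x⁴ − x⁶/3, if η(e)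
parametrizes the large oval for e > 2/81 and I_i(e) = ∫_{−η(e)}^{η(e)} x^i √(Q(x,e)) dx,
then for every a2 < −1/3 the set {e > 2/81 : a2 I_0(e) + I_2(e) = 0} has at most two
elements. -/
theorem stmt17 (η : ℝ → ℝ)
    (hη : ∀ e : ℝ, 2/81 < e →
      0 < η e ∧
      2 * e - (η e) ^ 2 / 3 + (2/3) * (η e) ^ 4 - (η e) ^ 6 / 3 = 0 ∧
      ∀ x : ℝ, |x| < η e → 0 < 2 * e - x ^ 2 / 3 + (2/3) * x ^ 4 - x ^ 6 / 3)
    (I : ℕ → ℝ → ℝ)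
    (hI : ∀ (i : ℕ) (e : ℝ), I i e =
      ∫ x in (-(η e))..(η e),
        x ^ i * Real.sqrt (2 * e - x ^ 2 / 3 + (2/3) * x ^ 4 - x ^ 6 / 3)) :
    ∀ a2 : ℝ, a2 < -1/3 →
      ∀ e1 ∈ {e : ℝ | 2/81 < e ∧ a2 * I 0 e + I 2 e = 0},
      ∀ e2 ∈ {e : ℝ | 2/81 < e ∧ a2 * I 0 e + I 2 e = 0},
      ∀ e3 ∈ {e : ℝ | 2/81 < e ∧ a2 * I 0 e + I 2 e = 0},
        e1 = e2 ∨ e1 = e3 ∨ e2 = e3 := by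
  intro a2 ha2
  have hfac (e : ℝ) (he : 2 / 81 < e) : 6 * e = η e ^ 2 * (η e ^ 2 - 1) ^ 2 := by
    linear_combination 3 * (hη e he).2.1
  have hgt (e : ℝ) (he : 2 / 81 < e) : 4 / 3 < η e ^ 2 := by
    by_contra! hle
    have := hfac e he
    nlinarith [mul_nonneg (sub_nonneg.2 hle) (sq_nonneg (η e ^ 2 - 1 / 3))]
  have hzero (e : ℝ) (he : 2 / 81 < e ∧ a2 * I 0 e + I 2 e = 0) :
      (3 * a2 + 1) * ovalIntegral (η e ^ 2) +
        Real.pi / 2 * (η e ^ 2 * (η e ^ 2 - 1) ^ 2) = 0 := by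
    have hone : 1 ≤ η e := by nlinarith [hgt e he.1, (hη e he.1).1]
    have hQ (x : ℝ) : 2 * e - x ^ 2 / 3 + (2 / 3) * x ^ 4 - x ^ 6 / 3 =
        (η e ^ 2 * (η e ^ 2 - 1) ^ 2 - (x ^ 3 - x) ^ 2) / 3 := by
      linear_combination (1 / 3) * hfac e he.1
    have h0 := he.2
    simp only [hI, hQ, pow_zero, one_mul] at h0
    exact ovalIntegral_combination_eq_zero hone h0
  have hinj {e f : ℝ} (he : 2 / 81 < e) (hf : 2 / 81 < f) (h : η e ^ 2 = η f ^ 2) : e = f := by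
    have h1 := hfac e he
    rw [h, ← hfac f hf] at h1
    linarith
  intro e1 h1 e2 h2 e3 h3
  by_contra! hne
  obtain ⟨h12, h13, h23⟩ := hne
  have n12 := mt (hinj h1.1 h2.1) h12
  have n13 := mt (hinj h1.1 h3.1) h13
  have n23 := mt (hinj h2.1 h3.1) h23
  have z1 := hzero e1 h1
  have z2 := hzero e2 h2
  have z3 := hzero e3 h3
  have g1 := hgt e1 h1.1
  have g2 := hgt e2 h2.1
  have g3 := hgt e3 h3.1
  have ha : 3 * a2 + 1 ≠ 0 := by linarith
  rcases lt_or_gt_of_ne n12 with l12 | l12 <;> rcases lt_or_gt_of_ne n13 with l13 | l13 <;>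
    rcases lt_or_gt_of_ne n23 with l23 | l23
  · exact ovalIntegral_combination_not_three_zeros ha g1 l12 l23 z1 z2 z3
  · exact ovalIntegral_combination_not_three_zeros ha g1 l13 l23 z1 z3 z2
  · linarith
  · exact ovalIntegral_combination_not_three_zeros ha g3 l13 l12 z3 z1 z2
  · exact ovalIntegral_combination_not_three_zeros ha g2 l12 l13 z2 z1 z3
  · linarith
  · exact ovalIntegral_combination_not_three_zeros ha g2 l23 l13 z2 z3 z1
  · exact ovalIntegral_combination_not_three_zeros ha g3 l23 l12 z3 z2 z1
end
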